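/- Let X ⊆ ℝ, let f : X → X be Borel measurable, and let μ be an f-invariant Borel probability measure on X. Then the sequence (h_μ(f, P_d))_{d∈ℕ} is monotonically nondecreasing, so that lim_{d→∞} h_μ(f, P_d) = sup_{d∈ℕ} h_μ(f, P_d) (possibly infinite). -/

import Mathlib

open MeasureTheory Filter Set Function
open scoped Classical ENNReal Topology

noncomputable section

/-- `ordIdx f d l x` is the inversion number `i_{d,l}(x)`, the `l`-th entry of the
ordinal pattern of order `d` realized by `x`:
`i_{d,l}(x) = #{r ∈ {0,…,l-1} : f^[d-r] x ≤ f^[d-l] x}`. -/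
def ordIdx {X : Set ℝ} (f : X → X) (d l : ℕ) (x : X) : ℕ :=
  ((Finset.range l).filter (fun r => f^[d - r] x ≤ f^[d - l] x)).card

/-- The partition `P_d = {P_i : i ∈ I_d}` of `X` into the sets of points realizing the
same ordinal pattern of order `d`, where an ordinal pattern `i ∈ I_d = ∏_{l=1}^d {0,…,l}`
is encoded as a dependent function `i : ∀ l : Fin d, Fin (l+2)` (so that `i l` is the
entry `i_{l+1} ∈ {0,…,l+1}`). -/
def patPartition {X : Set ℝ} (f : X → X) (d : ℕ) : Finset (Set X) :=
  Finset.image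
    (fun i : (∀ l : Fin d, Fin (l.val + 2)) =>
      {x : X | ∀ l : Fin d, ordIdx f d (l.val + 1) x = (i l).val})
    Finset.univ

/-- `𝒜` is a finite partition of `X` into Borel sets. -/
def IsFinPartition {X : Set ℝ} (𝒜 : Finset (Set X)) : Prop :=
  (∀ A ∈ 𝒜, MeasurableSet A) ∧
  (∀ A ∈ 𝒜, ∀ B ∈ 𝒜, A ≠ B → Disjoint A B) ∧
  ⋃₀ (𝒜 : Set (Set X)) = Set.univ

/-- The Shannon entropy `H(𝒜) = -∑_{A ∈ 𝒜} μ(A) ln μ(A)` of a finite partition `𝒜`. -/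
def partEntropy {X : Set ℝ} (μ : Measure X) (𝒜 : Finset (Set X)) : ℝ :=
  ∑ A ∈ 𝒜, Real.negMulLog (μ A).toReal

/-- The common refinement `⋁_{j=0}^{n-1} f^{-∘j}(𝒜)`, i.e. the partition of `X` into the
nonempty intersections `⋂_{j<n} f^{-∘j}(A_j)` with `A_j ∈ 𝒜`; it is the (unique up to
empty sets) partition generating the σ-algebra `⋁_{j=0}^{n-1} f^{-∘j}(𝒜)`. -/
def dynRefine {X : Set ℝ} (f : X → X) (𝒜 : Finset (Set X)) : ℕ → Finset (Set X)
  | 0 => {Set.univ}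
  | n + 1 =>
      ((dynRefine f 𝒜 n) ×ˢ (𝒜.image fun A => f^[n] ⁻¹' A)).image fun p => p.1 ∩ p.2

/-- `h_μ(f,𝒜) = lim_{n→∞} (1/n) H(⋁_{j=0}^{n-1} f^{-∘j}(𝒜))` (the limit exists and is
here expressed as a `limsup`). -/
def dynEntropy {X : Set ℝ} (μ : Measure X) (f : X → X) (𝒜 : Finset (Set X)) : ℝ :=
  Filter.limsup (fun n : ℕ => partEntropy μ (dynRefine f 𝒜 n) / n) Filter.atTop

/-- The Kolmogorov-Sinai entropy `h_μ(f) = sup {h_μ(f,𝒜) : 𝒜 finite Borel partition}`,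
as an extended nonnegative real. -/
def ksEntropy {X : Set ℝ} (μ : Measure X) (f : X → X) : ℝ≥0∞ :=
  ⨆ (𝒜 : Finset (Set X)) (_ : IsFinPartition 𝒜), ENNReal.ofReal (dynEntropy μ f 𝒜)

/-- The permutation entropy `h*_μ(f) = limsup_{d→∞} (1/d) H(P_d)`, as an extended
nonnegative real. -/
def permEntropy {X : Set ℝ} (μ : Measure X) (f : X → X) : ℝ≥0∞ :=
  Filter.limsup
    (fun d : ℕ => ENNReal.ofReal (partEntropy μ (patPartition f d)) / (d : ℝ≥0∞))
    Filter.atTop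

/-- Subadditivity of `x ↦ -x ln x` over finite sums of nonnegative reals. -/
lemma negMulLog_sum_le {ι : Type*} (s : Finset ι) (p : ι → ℝ) (hp : ∀ i ∈ s, 0 ≤ p i) :
    Real.negMulLog (∑ i ∈ s, p i) ≤ ∑ i ∈ s, Real.negMulLog (p i) := by
  simp only [Real.negMulLog, neg_mul, Finset.sum_neg_distrib, neg_le_neg_iff, Finset.sum_mul]
  refine Finset.sum_le_sum fun i hi => ?_
  rcases (hp i hi).eq_or_lt with h | h
  · simp [← h]
  · exact mul_le_mul_of_nonneg_left
      (Real.log_le_log h (Finset.single_le_sum hp hi)) h.le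

lemma partEntropy_nonneg {X : Set ℝ} (μ : Measure X) [IsProbabilityMeasure μ]
    (𝒜 : Finset (Set X)) : 0 ≤ partEntropy μ 𝒜 :=
  Finset.sum_nonneg fun _ _ =>
    Real.negMulLog_nonneg ENNReal.toReal_nonneg (measureReal_le_one (μ := μ))

/-- The measures of the pieces of a partition lying over `A` add up to the measure of `A`,
where `g` sends each piece to a set whose preimage contains it. -/
lemma measureReal_eq_sum_fiber {X : Set ℝ} {f : X → X} {μ : Measure X}
    [IsProbabilityMeasure μ] (hμ : MeasurePreserving f μ μ) {𝒜 ℬ : Finset (Set X)}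
    (h𝒜 : IsFinPartition 𝒜) (hℬ : IsFinPartition ℬ) {g : Set X → Set X}
    (hg : ∀ B ∈ ℬ, g B ∈ 𝒜 ∧ B ⊆ f ⁻¹' g B) {A : Set X} (hA : A ∈ 𝒜) :
    (μ A).toReal = ∑ B ∈ ℬ with g B = A, (μ B).toReal := by
  have hunion : f ⁻¹' A = ⋃ B ∈ ℬ.filter (fun B => g B = A), B := by
    ext x
    simp only [mem_preimage, mem_iUnion, Finset.mem_filter, exists_prop]
    constructor
    · intro hx
      obtain ⟨B, hB, hxB⟩ : x ∈ ⋃₀ (ℬ : Set (Set X)) := hℬ.2.2 ▸ mem_univ x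
      refine ⟨B, ⟨hB, ?_⟩, hxB⟩
      by_contra hne
      exact (disjoint_left.1 (h𝒜.2.1 _ (hg B hB).1 _ hA hne)) ((hg B hB).2 hxB) hx
    · rintro ⟨B, ⟨hB, rfl⟩, hxB⟩
      exact (hg B hB).2 hxB
  rw [← hμ.measure_preimage (h𝒜.1 A hA).nullMeasurableSet, hunion,
    measure_biUnion_finset, ENNReal.toReal_sum fun _ _ => measure_ne_top _ _]
  · intro B hB C hC hne
    exact hℬ.2.1 _ (Finset.mem_filter.1 hB).1 _ (Finset.mem_filter.1 hC).1 hne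
  · intro B hB
    exact hℬ.1 _ (Finset.mem_filter.1 hB).1

lemma partEntropy_le_of_refines_preimage {X : Set ℝ} {f : X → X} {μ : Measure X}
    [IsProbabilityMeasure μ] (hμ : MeasurePreserving f μ μ) {𝒜 ℬ : Finset (Set X)}
    (h𝒜 : IsFinPartition 𝒜) (hℬ : IsFinPartition ℬ)
    (h : ∀ B ∈ ℬ, ∃ A ∈ 𝒜, B ⊆ f ⁻¹' A) : partEntropy μ 𝒜 ≤ partEntropy μ ℬ := by
  choose! g hg using h
  calc partEntropy μ 𝒜
      = ∑ A ∈ 𝒜, Real.negMulLog (∑ B ∈ ℬ with g B = A, (μ B).toReal) :=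
        Finset.sum_congr rfl fun A hA => by
          rw [measureReal_eq_sum_fiber hμ h𝒜 hℬ hg hA]
    _ ≤ ∑ A ∈ 𝒜, ∑ B ∈ ℬ with g B = A, Real.negMulLog (μ B).toReal :=
        Finset.sum_le_sum fun A _ => negMulLog_sum_le _ _ fun _ _ => ENNReal.toReal_nonneg
    _ = partEntropy μ ℬ := Finset.sum_fiberwise_of_maps_to (fun B hB => (hg B hB).1) _

lemma sum_measure_toReal_eq_one {X : Set ℝ} (μ : Measure X) [IsProbabilityMeasure μ]
    {𝒜 : Finset (Set X)} (h𝒜 : IsFinPartition 𝒜) : ∑ A ∈ 𝒜, (μ A).toReal = 1 := by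
  rw [← ENNReal.toReal_sum fun _ _ => measure_ne_top _ _,
    ← measure_biUnion_finset (fun A hA B hB hne => h𝒜.2.1 A hA B hB hne) h𝒜.1]
  have : ⋃ A ∈ 𝒜, A = univ := by rw [← h𝒜.2.2, sUnion_eq_biUnion]; rfl
  rw [this, measure_univ, ENNReal.toReal_one]

lemma partEntropy_le_log_card {X : Set ℝ} (μ : Measure X) [IsProbabilityMeasure μ]
    {𝒜 : Finset (Set X)} (h𝒜 : IsFinPartition 𝒜) :
    partEntropy μ 𝒜 ≤ Real.log 𝒜.card := by
  have hsum := sum_measure_toReal_eq_one μ h𝒜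
  have hpos : (0 : ℝ) < 𝒜.card := by
    rw [Nat.cast_pos, Finset.card_pos, Finset.nonempty_iff_ne_empty]
    rintro rfl
    simp at hsum
  have key := Real.concaveOn_negMulLog.le_map_sum (t := 𝒜) (w := fun _ => (𝒜.card : ℝ)⁻¹)
    (p := fun A => (μ A).toReal) (fun _ _ => by positivity)
    (by simp [hpos.ne']) (fun _ _ => ENNReal.toReal_nonneg)
  simp only [smul_eq_mul, ← Finset.mul_sum, hsum, mul_one] at key
  rw [Real.negMulLog, Real.log_inv, neg_mul_neg] at key
  exact le_of_mul_le_mul_left key (inv_pos.2 hpos)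

lemma IsFinPartition.dynRefine {X : Set ℝ} {f : X → X} (hf : Measurable f)
    {𝒜 : Finset (Set X)} (h𝒜 : IsFinPartition 𝒜) (n : ℕ) :
    IsFinPartition (dynRefine f 𝒜 n) := by
  induction n with
  | zero => simp [_root_.dynRefine, IsFinPartition]
  | succ n ih =>
    have hmem : ∀ A, A ∈ _root_.dynRefine f 𝒜 (n + 1) ↔
        ∃ B ∈ _root_.dynRefine f 𝒜 n, ∃ C ∈ 𝒜, B ∩ f^[n] ⁻¹' C = A := by
      intro A
      simp only [_root_.dynRefine, Finset.mem_image, Finset.mem_product, Prod.exists]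
      constructor
      · rintro ⟨B, _, ⟨hB, C, hC, rfl⟩, rfl⟩
        exact ⟨B, hB, C, hC, rfl⟩
      · rintro ⟨B, hB, C, hC, rfl⟩
        exact ⟨B, _, ⟨hB, C, hC, rfl⟩, rfl⟩
    refine ⟨fun A hA => ?_, fun A hA A' hA' hne => ?_, ?_⟩
    · obtain ⟨B, hB, C, hC, rfl⟩ := (hmem A).1 hA
      exact (ih.1 B hB).inter (hf.iterate n (h𝒜.1 C hC))
    · obtain ⟨B, hB, C, hC, rfl⟩ := (hmem A).1 hA
      obtain ⟨B', hB', C', hC', rfl⟩ := (hmem A').1 hA'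
      by_cases hBB : B = B'
      · have hCC : C ≠ C' := fun h => hne (by rw [hBB, h])
        exact ((h𝒜.2.1 C hC C' hC' hCC).preimage _).mono inter_subset_right inter_subset_right
      · exact (ih.2.1 B hB B' hB' hBB).mono inter_subset_left inter_subset_left
    · refine eq_univ_of_forall fun x => ?_
      obtain ⟨B, hB, hxB⟩ : x ∈ ⋃₀ (_root_.dynRefine f 𝒜 n : Set (Set X)) :=
        ih.2.2 ▸ mem_univ x
      obtain ⟨C, hC, hxC⟩ : f^[n] x ∈ ⋃₀ (𝒜 : Set (Set X)) := h𝒜.2.2 ▸ mem_univ _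
      exact ⟨_, Finset.mem_coe.2 ((hmem _).2 ⟨B, hB, C, hC, rfl⟩), hxB, hxC⟩

lemma card_dynRefine_le {X : Set ℝ} (f : X → X) (𝒜 : Finset (Set X)) (n : ℕ) :
    (dynRefine f 𝒜 n).card ≤ 𝒜.card ^ n := by
  induction n with
  | zero => simp [dynRefine]
  | succ n ih =>
    rw [dynRefine, pow_succ]
    refine Finset.card_image_le.trans ?_
    rw [Finset.card_product]
    exact Nat.mul_le_mul ih Finset.card_image_le

lemma partEntropy_dynRefine_div_le {X : Set ℝ} {f : X → X} (hf : Measurable f)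
    (μ : Measure X) [IsProbabilityMeasure μ] {𝒜 : Finset (Set X)} (h𝒜 : IsFinPartition 𝒜)
    (n : ℕ) : partEntropy μ (dynRefine f 𝒜 n) / n ≤ Real.log 𝒜.card := by
  refine div_le_of_le_mul₀ n.cast_nonneg (Real.log_natCast_nonneg _) ?_
  have hlog := partEntropy_le_log_card μ (h𝒜.dynRefine hf n)
  rcases (dynRefine f 𝒜 n).card.eq_zero_or_pos with h0 | h0
  · rw [h0, Nat.cast_zero, Real.log_zero] at hlog
    exact hlog.trans (mul_nonneg (Real.log_natCast_nonneg _) n.cast_nonneg)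
  · calc partEntropy μ (dynRefine f 𝒜 n)
        ≤ Real.log ((dynRefine f 𝒜 n).card : ℝ) := hlog
      _ ≤ Real.log ((𝒜.card : ℝ) ^ n) :=
          Real.log_le_log (by exact_mod_cast h0) (by exact_mod_cast card_dynRefine_le f 𝒜 n)
      _ = Real.log 𝒜.card * n := by rw [Real.log_pow, mul_comm]

lemma dynRefine_refines_preimage {X : Set ℝ} {f : X → X} {𝒜 ℬ : Finset (Set X)}
    (h : ∀ B ∈ ℬ, ∃ A ∈ 𝒜, B ⊆ f ⁻¹' A) (n : ℕ) :
    ∀ B ∈ dynRefine f ℬ n, ∃ A ∈ dynRefine f 𝒜 n, B ⊆ f ⁻¹' A := by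
  induction n with
  | zero => simp [dynRefine]
  | succ n ih =>
    intro B hB
    simp only [dynRefine, Finset.mem_image, Finset.mem_product, Prod.exists] at hB
    obtain ⟨B₁, _, ⟨hB₁, C, hC, rfl⟩, rfl⟩ := hB
    obtain ⟨A₁, hA₁, hBA⟩ := ih B₁ hB₁
    obtain ⟨D, hD, hCD⟩ := h C hC
    refine ⟨A₁ ∩ f^[n] ⁻¹' D, ?_, fun x hx => ⟨hBA hx.1, ?_⟩⟩
    · exact Finset.mem_image.2 ⟨(A₁, f^[n] ⁻¹' D),
        Finset.mem_product.2 ⟨hA₁, Finset.mem_image_of_mem _ hD⟩, rfl⟩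
    · rw [mem_preimage, ← iterate_succ_apply, iterate_succ_apply']
      exact hCD hx.2

lemma dynEntropy_le_of_refines_preimage {X : Set ℝ} {f : X → X} {μ : Measure X}
    [IsProbabilityMeasure μ] (hμ : MeasurePreserving f μ μ) {𝒜 ℬ : Finset (Set X)}
    (h𝒜 : IsFinPartition 𝒜) (hℬ : IsFinPartition ℬ)
    (h : ∀ B ∈ ℬ, ∃ A ∈ 𝒜, B ⊆ f ⁻¹' A) : dynEntropy μ f 𝒜 ≤ dynEntropy μ f ℬ := by
  refine limsup_le_limsup (Eventually.of_forall fun n => ?_) ?_ ?_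
  · exact div_le_div_of_nonneg_right (partEntropy_le_of_refines_preimage hμ
      (h𝒜.dynRefine hμ.measurable n) (hℬ.dynRefine hμ.measurable n)
      (dynRefine_refines_preimage h n)) n.cast_nonneg
  · exact IsCoboundedUnder.of_frequently_ge (a := 0)
      (Frequently.of_forall fun n => div_nonneg (partEntropy_nonneg μ _) n.cast_nonneg)
  · exact isBoundedUnder_of ⟨_, partEntropy_dynRefine_div_le hμ.measurable μ hℬ⟩

lemma measurable_ordIdx {X : Set ℝ} {f : X → X} (hf : Measurable f) (d l : ℕ) :
    Measurable (ordIdx f d l) := by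
  unfold ordIdx
  simp only [Finset.card_filter]
  refine Finset.measurable_fun_sum _ fun r _ => Measurable.ite ?_ measurable_const measurable_const
  have hm (n : ℕ) : Measurable fun x => (f^[n] x : ℝ) :=
    measurable_subtype_coe.comp (hf.iterate n)
  have hle : MeasurableSet {x | (f^[d - r] x : ℝ) ≤ f^[d - l] x} :=
    measurableSet_le (hm (d - r)) (hm (d - l))
  exact hle

lemma ordIdx_le {X : Set ℝ} (f : X → X) (d l : ℕ) (x : X) : ordIdx f d l x ≤ l :=
  (Finset.card_filter_le _ _).trans (Finset.card_range l).le

lemma isFinPartition_patPartition {X : Set ℝ} {f : X → X} (hf : Measurable f) (d : ℕ) :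
    IsFinPartition (patPartition f d) := by
  refine ⟨fun A hA => ?_, fun A hA B hB hne => ?_, eq_univ_of_forall fun x => ?_⟩
  · obtain ⟨i, -, rfl⟩ := Finset.mem_image.1 hA
    rw [ofPred_forall]
    exact MeasurableSet.iInter fun l => measurable_ordIdx hf _ _ (measurableSet_singleton _)
  · obtain ⟨i, -, rfl⟩ := Finset.mem_image.1 hA
    obtain ⟨j, -, rfl⟩ := Finset.mem_image.1 hB
    refine disjoint_left.2 fun x hx hx' => hne ?_
    have hij : i = j := funext fun l => Fin.ext ((hx l).symm.trans (hx' l))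
    rw [hij]
  · exact ⟨_, Finset.mem_coe.2 (Finset.mem_image_of_mem _ (Finset.mem_univ
      fun l : Fin d => ⟨ordIdx f d (l.val + 1) x, Nat.lt_succ_of_le (ordIdx_le _ _ _ _)⟩)),
      fun _ => rfl⟩

lemma ordIdx_succ_order {X : Set ℝ} (f : X → X) {d l : ℕ} (hl : l ≤ d) (x : X) :
    ordIdx f (d + 1) l x = ordIdx f d l (f x) := by
  unfold ordIdx
  congr 1
  refine Finset.filter_congr fun r hr => ?_
  have hr' := Finset.mem_range.1 hr
  rw [Nat.succ_sub hl, Nat.succ_sub (by omega : r ≤ d), iterate_succ_apply, iterate_succ_apply]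

/-- The pattern of order `d + 1` of `x` determines the pattern of order `d` of `f x`. -/
lemma patPartition_succ_refines_preimage {X : Set ℝ} (f : X → X) (d : ℕ) :
    ∀ B ∈ patPartition f (d + 1), ∃ A ∈ patPartition f d, B ⊆ f ⁻¹' A := by
  intro B hB
  obtain ⟨i, -, rfl⟩ := Finset.mem_image.1 hB
  refine ⟨_, Finset.mem_image_of_mem _ (Finset.mem_univ fun l : Fin d => i l.castSucc),
    fun x hx l => ?_⟩
  rw [← ordIdx_succ_order f (Nat.succ_le_of_lt l.2)]
  exact hx l.castSucc

/-- The sequence `(h_μ(f, P_d))_{d∈ℕ}` of entropies of the ordinal pattern partitions is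
monotonically nondecreasing, so that its limit exists and equals
`sup_{d∈ℕ} h_μ(f, P_d)` (possibly infinite). -/
theorem dynEntropy_patPartition_monotone
    {X : Set ℝ} (f : X → X) (hf : Measurable f)
    (μ : Measure X) [IsProbabilityMeasure μ] (hμ : MeasurePreserving f μ μ) :
    (∀ d : ℕ, 1 ≤ d →
      dynEntropy μ f (patPartition f d) ≤ dynEntropy μ f (patPartition f (d + 1))) ∧
    Tendsto (fun d : ℕ => ENNReal.ofReal (dynEntropy μ f (patPartition f d))) atTop
      (nhds (⨆ d : ℕ, ENNReal.ofReal (dynEntropy μ f (patPartition f d)))) := by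
  have hmono (d : ℕ) :
      dynEntropy μ f (patPartition f d) ≤ dynEntropy μ f (patPartition f (d + 1)) :=
    dynEntropy_le_of_refines_preimage hμ (isFinPartition_patPartition hf d)
      (isFinPartition_patPartition hf (d + 1)) (patPartition_succ_refines_preimage f d)
  exact ⟨fun d _ => hmono d, tendsto_atTop_iSup
    (monotone_nat_of_le_succ fun d => ENNReal.ofReal_le_ofReal (hmono d))⟩
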